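/- Let r_1, r_2, … be a sequence of reward pairs with r_t(0), r_t(1) ∈ [0,1] and r_t(0) − r_t(1) = Δ for every t, let μ¹ be an arbitrary probability row vector on two states, and define μ^{t+1} = μ^t·Q(r_t) for t ≥ 1. Then for every t ≥ 1, ‖μ^t − μ‖₁ ≤ 2·(1 − p·e^{−η})^{t−1}. -/

import Mathlib

/-- The transition matrix of the exponential-switching dynamics: with
`q₀ = (1/2)e^{-η r₀}` and `q₁ = (1/2)e^{-η r₁}`, the first row is `(1 - q₀, q₀)`
and the second row is `(p q₁, 1 - p q₁)`. -/
noncomputable def Qmat (p η r0 r1 : ℝ) : Matrix (Fin 2) (Fin 2) ℝ :=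
  !![1 - (1 / 2) * Real.exp (-η * r0), (1 / 2) * Real.exp (-η * r0);
     p * ((1 / 2) * Real.exp (-η * r1)), 1 - p * ((1 / 2) * Real.exp (-η * r1))]

/-- The probability row vector `μ = (p/(p + e^{-ηΔ}), e^{-ηΔ}/(p + e^{-ηΔ}))`. -/
noncomputable def muStat (p η Δ : ℝ) : Fin 2 → ℝ :=
  ![p / (p + Real.exp (-η * Δ)), Real.exp (-η * Δ) / (p + Real.exp (-η * Δ))]

/-- Two exponential weights in `[exp (-η), 1]` give a switching rate between `p * exp (-η)`
and `1`. -/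
theorem switching_rate_mem_Icc {p η a b : ℝ} (hp : p ∈ Set.Ioc (0 : ℝ) 1) (hη : 0 < η)
    (ha : a ∈ Set.Icc (0 : ℝ) 1) (hb : b ∈ Set.Icc (0 : ℝ) 1) :
    (1 / 2) * Real.exp (-η * a) + p * ((1 / 2) * Real.exp (-η * b)) ∈
      Set.Icc (p * Real.exp (-η)) 1 := by
  obtain ⟨hp0, hp1⟩ := hp
  have bounds : ∀ x ∈ Set.Icc (0 : ℝ) 1,
      Real.exp (-η) ≤ Real.exp (-η * x) ∧ Real.exp (-η * x) ≤ 1 := by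
    rintro x ⟨hx0, hx1⟩
    exact ⟨Real.exp_le_exp.2 (by nlinarith), Real.exp_le_one_iff.2 (by nlinarith)⟩
  obtain ⟨ha0, ha1⟩ := bounds a ha
  obtain ⟨hb0, hb1⟩ := bounds b hb
  have he := Real.exp_pos (-η)
  constructor <;> nlinarith

/-- One step of the chain contracts the deviation from `muStat` by the factor
`1 - (q₀ + p q₁)`. -/
theorem vecMul_Qmat_sub_muStat {p η Δ a b : ℝ} (hp : 0 < p) (hab : a - b = Δ)
    (v : Fin 2 → ℝ) (hv : v 0 + v 1 = 1) :
    Matrix.vecMul v (Qmat p η a b) 0 - muStat p η Δ 0 =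
      (1 - ((1 / 2) * Real.exp (-η * a) + p * ((1 / 2) * Real.exp (-η * b)))) *
        (v 0 - muStat p η Δ 0) := by
  have hexp : Real.exp (-η * a) = Real.exp (-η * Δ) * Real.exp (-η * b) := by
    rw [← Real.exp_add, ← hab]
    ring_nf
  have hne : p + Real.exp (-η * Δ) ≠ 0 := by positivity
  have hv1 : v 1 = 1 - v 0 := by linarith
  simp only [Matrix.vecMul, dotProduct, Fin.sum_univ_two, Qmat, muStat, Matrix.of_apply,
    Matrix.cons_val_zero, Matrix.cons_val_one, hexp, hv1]
  field_simp
  ring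

theorem sum_vecMul_Qmat (p η a b : ℝ) (v : Fin 2 → ℝ) :
    Matrix.vecMul v (Qmat p η a b) 0 + Matrix.vecMul v (Qmat p η a b) 1 = v 0 + v 1 := by
  simp only [Matrix.vecMul, dotProduct, Fin.sum_univ_two, Qmat, Matrix.of_apply,
    Matrix.cons_val_zero, Matrix.cons_val_one]
  ring

theorem muStat_nonneg {p : ℝ} (hp : 0 < p) (η Δ : ℝ) (i : Fin 2) : 0 ≤ muStat p η Δ i := by
  fin_cases i <;> simp only [muStat] <;> simp <;> positivity

theorem muStat_add {p : ℝ} (hp : 0 < p) (η Δ : ℝ) :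
    muStat p η Δ 0 + muStat p η Δ 1 = 1 := by
  have hne : p + Real.exp (-η * Δ) ≠ 0 := by positivity
  simp only [muStat, Matrix.cons_val_zero, Matrix.cons_val_one]
  field_simp

/-- Mixing of the inhomogeneous chain: if `r_t(0), r_t(1) ∈ [0,1]` with
`r_t(0) - r_t(1) = Δ` for every `t ≥ 1`, `μ¹` is a probability row vector, and
`μ^{t+1} = μ^t · Q(r_t)`, then `‖μ^t - μ‖₁ ≤ 2 (1 - p e^{-η})^{t-1}` for all `t ≥ 1`. -/
theorem chain_mixing (p η Δ : ℝ)
    (hp : p ∈ Set.Ioc (0 : ℝ) 1) (hη : 0 < η) (hΔ : Δ ∈ Set.Icc (0 : ℝ) 1)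
    (r0 r1 : ℕ → ℝ)
    (hr : ∀ t, 1 ≤ t →
      r0 t ∈ Set.Icc (0 : ℝ) 1 ∧ r1 t ∈ Set.Icc (0 : ℝ) 1 ∧ r0 t - r1 t = Δ)
    (μseq : ℕ → Fin 2 → ℝ)
    (hinit : (∀ i, 0 ≤ μseq 1 i) ∧ ∑ i, μseq 1 i = 1)
    (hrec : ∀ t, 1 ≤ t →
      μseq (t + 1) = Matrix.vecMul (μseq t) (Qmat p η (r0 t) (r1 t))) :
    ∀ t, 1 ≤ t →
      ∑ i, |μseq t i - muStat p η Δ i| ≤ 2 * (1 - p * Real.exp (-η)) ^ (t - 1) := by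
  have hm := muStat_add hp.1 η Δ
  have key : ∀ t, 1 ≤ t → μseq t 0 + μseq t 1 = 1 ∧
      |μseq t 0 - muStat p η Δ 0| ≤ (1 - p * Real.exp (-η)) ^ (t - 1) := by
    intro t ht
    induction t, ht using Nat.le_induction with
    | base =>
      obtain ⟨hnn, hsum⟩ := hinit
      rw [Fin.sum_univ_two] at hsum
      refine ⟨hsum, ?_⟩
      have h0 := hnn 0
      have h1 := hnn 1
      have hm0 := muStat_nonneg hp.1 η Δ 0
      have hm1 := muStat_nonneg hp.1 η Δ 1
      rw [Nat.sub_self, pow_zero, abs_le]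
      constructor <;> linarith
    | succ t ht ih =>
      obtain ⟨hsum, hdev⟩ := ih
      obtain ⟨ha, hb, hab⟩ := hr t ht
      obtain ⟨hlo, hhi⟩ := switching_rate_mem_Icc hp hη ha hb
      rw [hrec t ht]
      refine ⟨(sum_vecMul_Qmat ..).trans hsum, ?_⟩
      rw [vecMul_Qmat_sub_muStat hp.1 hab _ hsum, abs_mul, abs_of_nonneg (by linarith),
        show t + 1 - 1 = (t - 1) + 1 by omega, pow_succ']
      exact mul_le_mul (by linarith) hdev (abs_nonneg _) (by linarith)
  intro t ht
  obtain ⟨hsum, hdev⟩ := key t ht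
  rw [Fin.sum_univ_two, show μseq t 1 - muStat p η Δ 1 = -(μseq t 0 - muStat p η Δ 0) by
    linarith, abs_neg]
  linarith
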